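/- arXiv:1910.09416 — 3 statements merged into one kernel-verified Lean document; each statement's English description precedes it below -/
import Mathlib

section
/- Let f: {-1,1}^n → {-1,1} be a Boolean function with a := |f^{-1}(1)|/2^n ≤ 1/2, and let m be an odd integer with 3 ≤ m ≤ n. Then the degree-m Fourier weight satisfies W_m ≤ 2a. -/
/-- The Boolean cube `{-1,1}^n` as a finset of functions `Fin n → ℤ`. -/
def cube (n : ℕ) : Finset (Fin n → ℤ) :=
  Fintype.piFinset fun _ => ({-1, 1} : Finset ℤ)

/-- The Fourier coefficient `f̂_S` of `f : {-1,1}^n → {-1,1}`. -/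
noncomputable def fCoeff (n : ℕ) (f : (Fin n → ℤ) → ℤ) (S : Finset (Fin n)) : ℝ :=
  ((2 : ℝ) ^ n)⁻¹ * ∑ x ∈ cube n, (f x : ℝ) * ∏ i ∈ S, (x i : ℝ)

/-- The degree-`m` Fourier weight `W_m` of `f`. -/
noncomputable def fourierWeight (n : ℕ) (f : (Fin n → ℤ) → ℤ) (m : ℕ) : ℝ :=
  ∑ S ∈ Finset.univ.filter (fun S : Finset (Fin n) => S.card = m), (fCoeff n f S) ^ 2

/-- The density `a = |f⁻¹(1)|/2^n` of the Boolean function `f`. -/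
noncomputable def density (n : ℕ) (f : (Fin n → ℤ) → ℤ) : ℝ :=
  (((cube n).filter fun x => f x = 1).card : ℝ) / 2 ^ n

theorem mem_cube_iff {n : ℕ} {x : Fin n → ℤ} : x ∈ cube n ↔ ∀ i, x i = -1 ∨ x i = 1 := by
  simp [cube]

theorem neg_mem_cube {n : ℕ} {x : Fin n → ℤ} (hx : x ∈ cube n) : -x ∈ cube n := by
  rw [mem_cube_iff] at hx ⊢
  intro i
  have := hx i
  simp only [Pi.neg_apply]
  omega

theorem sum_cube_neg {n : ℕ} (g : (Fin n → ℤ) → ℝ) :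
    ∑ x ∈ cube n, g (-x) = ∑ x ∈ cube n, g x :=
  Finset.sum_bij' (fun x _ => -x) (fun x _ => -x) (fun _ hx => neg_mem_cube hx)
    (fun _ hx => neg_mem_cube hx) (by simp) (by simp) (by simp)

/-- Orthogonality of the characters of the cube, summed over the characters. -/
theorem sum_character_mul {n : ℕ} {x y : Fin n → ℤ} (hx : x ∈ cube n) (hy : y ∈ cube n) :
    ∑ S : Finset (Fin n), (∏ i ∈ S, (x i : ℝ)) * ∏ i ∈ S, (y i : ℝ) =
      if x = y then (2 : ℝ) ^ n else 0 := by
  simp_rw [← Finset.prod_mul_distrib]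
  rw [← Finset.powerset_univ, ← Finset.prod_one_add]
  rw [mem_cube_iff] at hx hy
  split_ifs with h
  · subst h
    have h2 : ∀ i, (1 + (x i : ℝ) * (x i : ℝ)) = 2 := by
      intro i
      rcases hx i with h | h <;> norm_num [h]
    simp [h2]
  · obtain ⟨i, hi⟩ := Function.ne_iff.mp h
    refine Finset.prod_eq_zero (Finset.mem_univ i) ?_
    rcases hx i with h | h <;> rcases hy i with h' | h' <;> simp_all

/-- Parseval's identity on the cube. -/
theorem sum_sq_sum_mul_character {n : ℕ} (g : (Fin n → ℤ) → ℝ) :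
    ∑ S : Finset (Fin n), (∑ x ∈ cube n, g x * ∏ i ∈ S, (x i : ℝ)) ^ 2 =
      2 ^ n * ∑ x ∈ cube n, g x ^ 2 := by
  simp_rw [sq, Finset.sum_mul_sum]
  rw [Finset.sum_comm, Finset.mul_sum]
  refine Finset.sum_congr rfl fun x hx => ?_
  rw [Finset.sum_comm]
  calc _ = ∑ y ∈ cube n, g x * g y * (if x = y then (2 : ℝ) ^ n else 0) := by
        refine Finset.sum_congr rfl fun y hy => ?_
        rw [← sum_character_mul hx hy, Finset.mul_sum]
        exact Finset.sum_congr rfl fun S _ => by ring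
    _ = _ := by
        simp only [mul_ite, mul_zero, Finset.sum_ite_eq, hx, if_true]
        ring

/-- Odd-degree characters only see the odd part of a function. -/
theorem sum_mul_character_of_odd {n : ℕ} (g : (Fin n → ℤ) → ℝ) {S : Finset (Fin n)}
    (hS : Odd S.card) :
    ∑ x ∈ cube n, g x * ∏ i ∈ S, (x i : ℝ) =
      ∑ x ∈ cube n, (g x - g (-x)) / 2 * ∏ i ∈ S, (x i : ℝ) := by
  have h := sum_cube_neg fun x => g x * ∏ i ∈ S, (x i : ℝ)
  simp only [Pi.neg_apply, Int.cast_neg, Finset.prod_neg, hS.neg_one_pow] at h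
  have h2 : ∑ x ∈ cube n, (g x - g (-x)) / 2 * ∏ i ∈ S, (x i : ℝ) =
      (∑ x ∈ cube n, g x * ∏ i ∈ S, (x i : ℝ) +
        ∑ x ∈ cube n, g (-x) * (-1 * ∏ i ∈ S, (x i : ℝ))) / 2 := by
    rw [← Finset.sum_add_distrib, Finset.sum_div]
    exact Finset.sum_congr rfl fun x _ => by ring
  rw [h2, h]
  ring

theorem sum_sq_odd_part_le {n : ℕ} (f : (Fin n → ℤ) → ℤ)
    (hf : ∀ x ∈ cube n, f x = -1 ∨ f x = 1) :
    ∑ x ∈ cube n, (((f x : ℝ) - f (-x)) / 2) ^ 2 ≤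
      2 * (((cube n).filter fun x => f x = 1).card : ℝ) := by
  have hcard : (((cube n).filter fun x => f x = 1).card : ℝ) =
      ∑ x ∈ cube n, if f x = 1 then (1 : ℝ) else 0 := by simp
  have hneg := sum_cube_neg fun x : Fin n → ℤ => if f x = 1 then (1 : ℝ) else 0
  calc _ ≤ ∑ x ∈ cube n, ((if f x = 1 then (1 : ℝ) else 0) + if f (-x) = 1 then 1 else 0) := by
        refine Finset.sum_le_sum fun x hx => ?_
        rcases hf x hx with h | h <;> rcases hf _ (neg_mem_cube hx) with h' | h' <;>
          norm_num [h, h']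
    _ = _ := by
        rw [Finset.sum_add_distrib, hneg, hcard]
        ring

theorem weight_odd_le (n m : ℕ) (f : (Fin n → ℤ) → ℤ)
    (hf : ∀ x ∈ cube n, f x = -1 ∨ f x = 1)
    (ha : density n f ≤ 1 / 2)
    (hm : Odd m) (hm3 : 3 ≤ m) (hmn : m ≤ n) :
    fourierWeight n f m ≤ 2 * density n f := by
  have hpos : (0 : ℝ) < 2 ^ n := by positivity
  set d : (Fin n → ℤ) → ℝ := fun x => ((f x : ℝ) - f (-x)) / 2
  calc fourierWeight n f m
      = ∑ S ∈ Finset.univ.filter (fun S : Finset (Fin n) => S.card = m),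
          (((2 : ℝ) ^ n)⁻¹) ^ 2 * (∑ x ∈ cube n, d x * ∏ i ∈ S, (x i : ℝ)) ^ 2 := by
        refine Finset.sum_congr rfl fun S hS => ?_
        have hodd : Odd S.card := by rwa [(Finset.mem_filter.mp hS).2]
        rw [fCoeff, sum_mul_character_of_odd (fun x => (f x : ℝ)) hodd, mul_pow]
    _ ≤ ∑ S : Finset (Fin n),
          (((2 : ℝ) ^ n)⁻¹) ^ 2 * (∑ x ∈ cube n, d x * ∏ i ∈ S, (x i : ℝ)) ^ 2 :=
        Finset.sum_le_sum_of_subset_of_nonneg (Finset.filter_subset _ _)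
          fun _ _ _ => by positivity
    _ = ((2 : ℝ) ^ n)⁻¹ * ∑ x ∈ cube n, d x ^ 2 := by
        rw [← Finset.mul_sum, sum_sq_sum_mul_character]
        field_simp
    _ ≤ ((2 : ℝ) ^ n)⁻¹ * (2 * (((cube n).filter fun x => f x = 1).card : ℝ)) := by
        gcongr
        exact sum_sq_odd_part_le f hf
    _ = 2 * density n f := by
        rw [density]
        ring
end

section
/- Fix a real number a with 0 < a ≤ 1/2 and a fixed even integer m ≥ 2. Then the limit as n → ∞ of Φ̄_m(n;a) exists and equals 0. -/
/-- Generalized binomial coefficient `C(y,j) = y(y-1)⋯(y-j+1)/j!`. -/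
noncomputable def genChoose (y : ℝ) (j : ℕ) : ℝ :=
  (∏ i ∈ Finset.range j, (y - i)) / (Nat.factorial j)

/-- The Krawtchouk polynomial `K_k^{(n)}(x)`. -/
noncomputable def kraw (n k : ℕ) (x : ℝ) : ℝ :=
  ∑ j ∈ Finset.range (k + 1), (-1 : ℝ) ^ j * genChoose x j * genChoose ((n : ℝ) - x) (k - j)

/-- The value `Φ̄_m(n;a)` of the dual linear program for the degree-`m` Fourier weight. -/
noncomputable def PhiBar (m n : ℕ) (a : ℝ) : ℝ :=
  sSup {v : ℝ | ∃ x : ℕ → ℝ,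
    (∀ k ∈ Finset.Icc 1 n, 0 ≤ x k) ∧
    (∀ i ∈ Finset.Icc 1 n, i ≠ m →
      -1 ≤ ∑ k ∈ Finset.Icc 1 n, (kraw n k (m : ℝ) - kraw n k (i : ℝ)) * x k) ∧
    v = -∑ k ∈ Finset.Icc 1 n, (kraw n k 0 + (1 / a - 1) * kraw n k (m : ℝ)) * x k}

open Finset

lemma genChoose_natCast (n j : ℕ) : genChoose (n : ℝ) j = n.choose j := by
  rw [genChoose, ← descPochhammer_eval_eq_prod_range, descPochhammer_eval_eq_descFactorial,
    Nat.descFactorial_eq_factorial_mul_choose, Nat.cast_mul,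
    mul_div_cancel_left₀ _ (Nat.cast_ne_zero.2 j.factorial_ne_zero)]

/-- The character `i ↦ -1` on `S` and `1` off `S`. -/
noncomputable def setSign {n : ℕ} (S : Finset (Fin n)) (i : Fin n) : ℝ := if i ∈ S then -1 else 1

lemma prod_setSign_comm {n : ℕ} (S T : Finset (Fin n)) :
    ∏ i ∈ T, setSign S i = ∏ i ∈ S, setSign T i := by
  simp only [setSign, prod_ite_mem, prod_const, inter_comm]

lemma abs_setSign {n : ℕ} (S : Finset (Fin n)) (i : Fin n) : |setSign S i| = 1 := by
  unfold setSign
  split_ifs <;> simp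

open Polynomial in
lemma coeff_one_sub_X_pow (m j : ℕ) :
    ((1 - X : ℝ[X]) ^ m).coeff j = (-1) ^ j * m.choose j := by
  have h : (1 - X : ℝ[X]) ^ m = ((1 + X) ^ m).comp (C (-1) * X) := by
    simp [sub_eq_add_neg]
  rw [h, comp_C_mul_X_coeff, coeff_one_add_X_pow, mul_comm]

open Polynomial in
lemma kraw_card_eq_coeff {n : ℕ} (k : ℕ) (T : Finset (Fin n)) :
    kraw n k (#T : ℝ) = ((1 - X : ℝ[X]) ^ #T * (1 + X) ^ (n - #T)).coeff k := by
  have hT : #T ≤ n := by simpa using card_le_univ T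
  rw [coeff_mul, Nat.sum_antidiagonal_eq_sum_range_succ
    (fun i j => ((1 - X : ℝ[X]) ^ #T).coeff i * ((1 + X : ℝ[X]) ^ (n - #T)).coeff j), kraw]
  refine sum_congr rfl fun j _ => ?_
  rw [coeff_one_sub_X_pow, coeff_one_add_X_pow, ← Nat.cast_sub hT, genChoose_natCast,
    genChoose_natCast]

open Polynomial in
lemma sum_powersetCard_prod_setSign {n : ℕ} (k : ℕ) (T : Finset (Fin n)) :
    ∑ S ∈ powersetCard k univ, ∏ i ∈ T, setSign S i = kraw n k (#T : ℝ) := by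
  have h : (1 - X : ℝ[X]) ^ #T * (1 + X) ^ (n - #T) =
      ∏ i : Fin n, (1 + C (setSign T i) * X) := by
    rw [← prod_mul_prod_compl T]
    congr 1
    · rw [prod_congr rfl (g := fun _ => (1 - X : ℝ[X]))]
      · simp
      · intro i hi
        simp [setSign, hi, sub_eq_add_neg]
    · rw [prod_congr rfl (g := fun _ => (1 + X : ℝ[X]))]
      · simp [card_compl]
      · intro i hi
        simp [setSign, mem_compl.1 hi]
  rw [kraw_card_eq_coeff, h, prod_one_add, finsetSum_coeff, powersetCard_eq_filter, sum_filter]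
  refine sum_congr rfl fun S _ => ?_
  rw [prod_setSign_comm, prod_mul_distrib, prod_const, ← map_prod, coeff_C_mul_X_pow]
  simp only [eq_comm]

lemma kraw_zero (n k : ℕ) : kraw n k 0 = n.choose k := by
  simpa using (sum_powersetCard_prod_setSign k (∅ : Finset (Fin n))).symm

lemma sum_prod_setSign_of_injective {n m : ℕ} (k : ℕ) {f : Fin m → Fin n}
    (hf : Function.Injective f) :
    ∑ S ∈ powersetCard k univ, ∏ j, setSign S (f j) = kraw n k (m : ℝ) := by
  have h := sum_powersetCard_prod_setSign k (univ.image f)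
  rw [card_image_of_injective _ hf, card_univ, Fintype.card_fin] at h
  rw [← h]
  exact sum_congr rfl fun S _ => (prod_image hf.injOn).symm

lemma sum_prod_setSign_le {n m : ℕ} (k : ℕ) (f : Fin m → Fin n) :
    ∑ S ∈ powersetCard k univ, ∏ j, setSign S (f j) ≤ n.choose k := by
  calc _ ≤ ∑ S ∈ powersetCard k (univ : Finset (Fin n)), (1 : ℝ) := by
        refine sum_le_sum fun S _ => (le_abs_self _).trans ?_
        simp [abs_prod, abs_setSign]
    _ = n.choose k := by simp

lemma card_filter_injective (m n : ℕ) :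
    #{f : Fin m → Fin n | Function.Injective f} = n.descFactorial m := by
  rw [← Fintype.card_subtype, Fintype.card_congr (Equiv.subtypeInjectiveEquivEmbedding _ _),
    Fintype.card_embedding_eq, Fintype.card_fin, Fintype.card_fin]

lemma card_filter_not_injective (m n : ℕ) :
    (#{f : Fin m → Fin n | ¬ Function.Injective f} : ℝ) = (n : ℝ) ^ m - n.descFactorial m := by
  have h := card_filter_add_card_filter_not (s := (univ : Finset (Fin m → Fin n)))
    (fun f => Function.Injective f)
  rw [card_filter_injective, card_univ, Fintype.card_fun, Fintype.card_fin, Fintype.card_fin] at h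
  rw [eq_sub_iff_add_eq']
  exact_mod_cast h

/-- For even `m`, comparing `∑_S (∑ i, setSign S i) ^ m ≥ 0` with its injective part bounds
`kraw n k m` from below. -/
lemma descFactorial_mul_kraw_ge {m : ℕ} (hm : Even m) (n k : ℕ) :
    0 ≤ n.descFactorial m * kraw n k (m : ℝ) +
      ((n : ℝ) ^ m - n.descFactorial m) * n.choose k := by
  calc (0 : ℝ) ≤ ∑ S ∈ powersetCard k (univ : Finset (Fin n)), (∑ i, setSign S i) ^ m :=
        sum_nonneg fun S _ => hm.pow_nonneg _
    _ = ∑ f : Fin m → Fin n, ∑ S ∈ powersetCard k univ, ∏ j, setSign S (f j) := by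
        rw [sum_comm]
        exact sum_congr rfl fun S _ => Fintype.sum_pow _ _
    _ ≤ _ := by
        rw [← sum_filter_add_sum_filter_not _ (fun f => Function.Injective f)]
        refine add_le_add (le_of_eq ?_) ?_
        · rw [sum_congr rfl fun f hf => sum_prod_setSign_of_injective k (mem_filter.1 hf).2,
            sum_const, card_filter_injective, nsmul_eq_mul]
        · rw [← card_filter_not_injective, ← nsmul_eq_mul]
          exact sum_le_card_nsmul _ _ _ fun f _ => sum_prod_setSign_le k f

lemma eventually_mul_pow_le_descFactorial (m : ℕ) {b : ℝ} (hb : 0 ≤ b) :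
    ∀ᶠ n : ℕ in Filter.atTop, b * (n : ℝ) ^ m ≤ (1 + b) * n.descFactorial m := by
  have hpos : 0 < 1 + b := by linarith
  filter_upwards [(isEquivalent_descFactorial m).isLittleO.def
    (show (0 : ℝ) < 1 / (1 + b) by positivity)] with n hn
  have h := (abs_le.1 hn).1
  simp only [Real.norm_eq_abs, Pi.sub_apply] at h
  rw [abs_of_nonneg (by positivity), one_div, inv_mul_eq_div, neg_le_iff_add_nonneg] at h
  have := mul_nonneg hpos.le h
  rw [mul_add, mul_div_cancel₀ _ hpos.ne'] at this
  linarith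

lemma kraw_zero_add_mul_nonneg {m : ℕ} (hm : Even m) {n : ℕ} (hmn : m ≤ n) {b : ℝ} (hb : 0 ≤ b)
    (h : b * (n : ℝ) ^ m ≤ (1 + b) * n.descFactorial m) (k : ℕ) :
    0 ≤ kraw n k 0 + b * kraw n k (m : ℝ) := by
  have hd : (0 : ℝ) < n.descFactorial m := by
    exact_mod_cast Nat.pos_of_ne_zero (mt Nat.descFactorial_eq_zero_iff_lt.1 hmn.not_gt)
  rw [kraw_zero]
  refine nonneg_of_mul_nonneg_right (a := (n.descFactorial m : ℝ)) ?_ hd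
  have h₁ := mul_nonneg hb (descFactorial_mul_kraw_ge hm n k)
  have h₂ := mul_le_mul_of_nonneg_right h (Nat.cast_nonneg (α := ℝ) (n.choose k))
  linarith

lemma phiBar_eq_zero {m n : ℕ} {a : ℝ}
    (h : ∀ k, 0 ≤ kraw n k 0 + (1 / a - 1) * kraw n k (m : ℝ)) : PhiBar m n a = 0 := by
  refine IsGreatest.csSup_eq ⟨⟨0, by simp, by simp, by simp⟩, ?_⟩
  rintro v ⟨x, hx, -, rfl⟩
  exact neg_nonpos.2 (sum_nonneg fun k hk => mul_nonneg (h k) (hx k hk))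

theorem phiBar_tendsto_even (a : ℝ) (ha0 : 0 < a) (ha : a ≤ 1 / 2)
    (m : ℕ) (hm : Even m) (hm2 : 2 ≤ m) :
    Filter.Tendsto (fun n : ℕ => PhiBar m n a) Filter.atTop (nhds 0) := by
  have hb : 0 ≤ 1 / a - 1 := by
    rw [sub_nonneg, le_div_iff₀ ha0]
    linarith
  refine tendsto_const_nhds.congr' ?_
  filter_upwards [eventually_mul_pow_le_descFactorial m hb, Filter.eventually_ge_atTop m]
    with n hn hmn
  exact (phiBar_eq_zero (kraw_zero_add_mul_nonneg hm hmn hb hn)).symm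
end

section
/- Let i be a nonnegative integer and let β be a real number with 0 < β < 1/2. Then, with k_n := ⌊βn⌋, the sequence K_{k_n}^{(n)}(i) / binom(n, k_n) converges to (1−2β)^i as n → ∞. -/
theorem genChoose_natCast_s15 (m j : ℕ) : genChoose (m : ℝ) j = (m.choose j : ℝ) := by
  have h : ∏ i ∈ Finset.range j, ((m : ℝ) - i) = (m.descFactorial j : ℝ) := by
    induction j with
    | zero => simp
    | succ j ih =>
      rw [Finset.prod_range_succ, ih, Nat.descFactorial_succ]
      rcases le_or_gt j m with hj | hj
      · push_cast [hj]
        ring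
      · simp [Nat.descFactorial_of_lt hj]
  rw [genChoose, h, Nat.descFactorial_eq_factorial_mul_choose]
  push_cast
  field_simp

theorem kraw_natCast {n k i : ℕ} (hin : i ≤ n) (hik : i ≤ k) :
    kraw n k (i : ℝ) =
      ∑ j ∈ Finset.range (i + 1), (-1 : ℝ) ^ j * i.choose j * (n - i).choose (k - j) := by
  rw [kraw, ← Nat.cast_sub hin]
  simp only [genChoose_natCast_s15]
  refine (Finset.sum_subset (Finset.range_mono (by lia)) fun j _ hj => ?_).symm
  rw [Nat.choose_eq_zero_of_lt (by simpa using hj)]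
  simp

theorem choose_mul_descFactorial_add (a b j m : ℕ) :
    (a + b).choose a * (a + j + (b + m)).descFactorial (j + m) =
      (a + j + (b + m)).choose (a + j) * ((a + j).descFactorial j * (b + m).descFactorial m) := by
  have h₁ := Nat.add_choose_mul_factorial_mul_factorial a b
  have h₂ := Nat.add_choose_mul_factorial_mul_factorial (a + j) (b + m)
  have h₃ := Nat.factorial_mul_descFactorial (n := a + j) (k := j) (by lia)
  have h₄ := Nat.factorial_mul_descFactorial (n := b + m) (k := m) (by lia)
  have h₅ := Nat.factorial_mul_descFactorial (n := a + j + (b + m)) (k := j + m) (by lia)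
  rw [show a + j - j = a by lia] at h₃
  rw [show b + m - m = b by lia] at h₄
  rw [show a + j + (b + m) - (j + m) = a + b by lia, ← h₁, ← h₂, ← h₃, ← h₄] at h₅
  have hpos : 0 < a.factorial * b.factorial := by positivity
  refine Nat.eq_of_mul_eq_mul_left hpos ?_
  rw [Nat.choose_symm_add, Nat.choose_symm_add]
  linarith

theorem choose_sub_div_choose {n k i j : ℕ} (hj : j ≤ i) (hk : i ≤ k) (hn : k + i ≤ n) :
    ((n - i).choose (k - j) : ℝ) / n.choose k =
      k.descFactorial j * (n - k).descFactorial (i - j) / n.descFactorial i := by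
  have h := choose_mul_descFactorial_add (k - j) (n - k - (i - j)) j (i - j)
  rw [show k - j + (n - k - (i - j)) = n - i by lia, show k - j + j = k by lia,
    show n - k - (i - j) + (i - j) = n - k by lia, show k + (n - k) = n by lia,
    show j + (i - j) = i by lia] at h
  have h₁ : (n.choose k : ℝ) ≠ 0 := by exact_mod_cast (Nat.choose_pos (by lia)).ne'
  have h₂ : (n.descFactorial i : ℝ) ≠ 0 := by
    exact_mod_cast (Nat.descFactorial_pos.2 (by lia)).ne'
  rw [div_eq_div_iff h₁ h₂, mul_comm (_ * _) (n.choose k : ℝ)]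
  exact_mod_cast h

theorem tendsto_descFactorial_div_pow {u : ℕ → ℕ} {γ : ℝ}
    (hu : Filter.Tendsto (fun n : ℕ => (u n : ℝ) / n) Filter.atTop (nhds γ)) (m : ℕ) :
    Filter.Tendsto (fun n : ℕ => ((u n).descFactorial m : ℝ) / (n : ℝ) ^ m)
      Filter.atTop (nhds (γ ^ m)) := by
  induction m with
  | zero => simp
  | succ m ih =>
    have hsub : Filter.Tendsto (fun n : ℕ => ((u n - m : ℕ) : ℝ) / n) Filter.atTop (nhds γ) := by
      have hlow := hu.sub (tendsto_const_div_atTop_nhds_zero_nat (m : ℝ))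
      rw [sub_zero] at hlow
      refine tendsto_of_tendsto_of_tendsto_of_le_of_le hlow hu (fun n => ?_) fun n => ?_
      · dsimp only
        rw [← sub_div]
        gcongr
        rw [sub_le_iff_le_add]
        exact_mod_cast le_tsub_add
      · dsimp only
        gcongr
        exact Nat.sub_le _ _
    rw [pow_succ']
    refine (hsub.mul ih).congr fun n => ?_
    rw [Nat.descFactorial_succ, pow_succ', div_mul_div_comm]
    push_cast
    rfl

theorem tendsto_natFloor_mul_div {β : ℝ} (hβ : 0 ≤ β) :
    Filter.Tendsto (fun n : ℕ => (⌊β * n⌋₊ : ℝ) / n) Filter.atTop (nhds β) :=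
  (tendsto_nat_floor_mul_div_atTop hβ).comp tendsto_natCast_atTop_atTop

theorem tendsto_sub_natFloor_mul_div {β : ℝ} (hβ0 : 0 ≤ β) (hβ : β ≤ 1) :
    Filter.Tendsto (fun n : ℕ => ((n - ⌊β * n⌋₊ : ℕ) : ℝ) / n) Filter.atTop
      (nhds (1 - β)) := by
  refine ((tendsto_natFloor_mul_div hβ0).const_sub 1).congr' ?_
  filter_upwards [Filter.eventually_gt_atTop 0] with n hn
  have hle : ⌊β * n⌋₊ ≤ n := Nat.floor_le_of_le (mul_le_of_le_one_left n.cast_nonneg hβ)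
  rw [Nat.cast_sub hle, sub_div, div_self (by positivity)]

theorem tendsto_descFactorial_ratio {β : ℝ} (hβ0 : 0 ≤ β) (hβ : β ≤ 1) {i j : ℕ} (hj : j ≤ i) :
    Filter.Tendsto
      (fun n : ℕ => (⌊β * n⌋₊.descFactorial j * (n - ⌊β * n⌋₊).descFactorial (i - j) /
        n.descFactorial i : ℝ))
      Filter.atTop (nhds (β ^ j * (1 - β) ^ (i - j))) := by
  have hid : Filter.Tendsto (fun n : ℕ => ((id n : ℕ) : ℝ) / n) Filter.atTop (nhds 1) := by
    refine tendsto_const_nhds.congr' ?_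
    filter_upwards [Filter.eventually_gt_atTop 0] with n hn
    rw [id, div_self (by positivity)]
  have h := ((tendsto_descFactorial_div_pow (tendsto_natFloor_mul_div hβ0) j).mul
    (tendsto_descFactorial_div_pow (tendsto_sub_natFloor_mul_div hβ0 hβ) (i - j))).div
    (tendsto_descFactorial_div_pow hid i) (by simp)
  rw [one_pow, div_one] at h
  refine h.congr' ?_
  filter_upwards [Filter.eventually_gt_atTop 0] with n hn
  have hn' : (n : ℝ) ^ i ≠ 0 := by positivity
  simp only [Pi.div_apply, id]
  rw [div_mul_div_comm, ← pow_add, Nat.add_sub_cancel' hj, div_div_div_cancel_right₀ hn']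

theorem kraw_div_choose_tendsto (i : ℕ) (β : ℝ) (hβ0 : 0 < β) (hβ : β < 1 / 2) :
    Filter.Tendsto
      (fun n : ℕ => kraw n ⌊β * n⌋₊ (i : ℝ) / (n.choose ⌊β * n⌋₊ : ℝ))
      Filter.atTop (nhds ((1 - 2 * β) ^ i)) := by
  have hβ1 : β ≤ 1 := by linarith
  have hsum : (1 - 2 * β) ^ i = ∑ j ∈ Finset.range (i + 1),
      (-1 : ℝ) ^ j * i.choose j * (β ^ j * (1 - β) ^ (i - j)) := by
    rw [show 1 - 2 * β = -β + (1 - β) by ring, add_pow]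
    refine Finset.sum_congr rfl fun j _ => ?_
    rw [neg_pow]
    ring
  rw [hsum]
  refine (tendsto_finsetSum _ fun j hj => (tendsto_descFactorial_ratio hβ0.le hβ1
    (Nat.lt_succ_iff.1 (Finset.mem_range.1 hj))).const_mul
      ((-1 : ℝ) ^ j * i.choose j)).congr' ?_
  have hfloor : Filter.Tendsto (fun n : ℕ => ⌊β * n⌋₊) Filter.atTop Filter.atTop :=
    tendsto_nat_floor_atTop.comp (tendsto_natCast_atTop_atTop.const_mul_atTop hβ0)
  filter_upwards [hfloor.eventually_ge_atTop i] with n hik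
  have hkn : ⌊β * n⌋₊ + ⌊β * n⌋₊ ≤ n := by
    have h := Nat.floor_le (show 0 ≤ β * n by positivity)
    have h' : β * n ≤ 1 / 2 * n := by gcongr
    have : (⌊β * n⌋₊ : ℝ) + ⌊β * n⌋₊ ≤ n := by linarith
    exact_mod_cast this
  rw [kraw_natCast (by lia) hik, Finset.sum_div]
  refine Finset.sum_congr rfl fun j hj => ?_
  rw [mul_div_assoc (_ * _) (Nat.cast (Nat.choose _ _)), choose_sub_div_choose (Nat.lt_succ_iff.1 (Finset.mem_range.1 hj)) hik
    (by lia)]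
end
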